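/- Let n ≥ 2 and c ≥ 0 be integers. Then, in ℚ(q): if c is even, U_{n,c}(0) = ( 2·∏_{i=1}^{n−2}(1+q^i) / (1+q)^{n−1} ) · ∏_{i=0}^{n−2} (1−q^{c+1+i})(1−q^2)/((1−q)(1−q^{c+1+2i})); if c is odd, U_{n,c}(0) = ( 2·∏_{i=1}^{n−2}(1+q^i) / (1+q)^{n} ) · ∏_{i=0}^{n−1} (1−q^{c+i})(1−q^2)/((1−q)(1−q^{c+2i})). -/

import Mathlib

open Finset

noncomputable def q : RatFunc ℚ := RatFunc.X

noncomputable def qb (a : ℤ) : RatFunc ℚ := (1 - q ^ a) / (1 - q)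

noncomputable def qfac (a : ℤ) (n : ℕ) : RatFunc ℚ := ∏ i ∈ Finset.range n, qb (a + i)

noncomputable def binq (n k : ℤ) : RatFunc ℚ :=
  if 0 ≤ k ∧ k ≤ n then qfac (n - k + 1) k.toNat / qfac 1 k.toNat else 0

noncomputable def Wnc (n c : ℕ) (k : ℤ) : RatFunc ℚ :=
  qfac (k + 1) (n - 1) * qfac (k - c - n + 1) (n - 1)

noncomputable def Unc (n c : ℕ) (k : ℤ) : RatFunc ℚ :=
  (-1 : RatFunc ℚ) ^ n * q ^ (((n : ℤ) - 1) * (2 * c + n) / 2) *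
    (∑ i ∈ Finset.Icc 1 (n - 1),
      ((-1 : RatFunc ℚ) ^ c * q ^ (i * (i - 1) / 2) *
          (qfac (k + 1) (n - 1) * qfac (k - c - i + 1) (i - 1) *
            qfac (k - c - n + 1) (n - i - 1)) -
        q ^ (i * (i - 1) / 2) *
          (qfac (k + 1) (i - 1) * qfac (k + i + 1) (n - i - 1) *
            qfac (k - c - n + 1) (n - 1))) /
      (qfac 1 (i - 1) * qfac 1 (n - 1 - i) * qfac (c + i + 1) (n - 1))) +
  (-1 : RatFunc ℚ) ^ k * q ^ (((n : ℤ) - 1) * k)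

/-- The coefficient `∏_{j < m} (p^j - M) (1 - a p^(j+1)) / ((1 - p^(j+1)) (1 - b p^(j+1)))`
of a terminating basic hypergeometric series (terminating when `M` is a power of `p`). -/
def hyperCoeff {K : Type*} [Field K] (p a b M : K) (m : ℕ) : K :=
  ∏ j ∈ Finset.range m,
    ((p ^ j - M) * (1 - a * p ^ (j + 1))) / ((1 - p ^ (j + 1)) * (1 - b * p ^ (j + 1)))

section Hypergeometric

variable {K : Type*} [Field K] {p a M : K}

lemma hyperCoeff_zero (b : K) : hyperCoeff p a b M 0 = 1 := by simp [hyperCoeff]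

lemma hyperCoeff_succ (b : K) (m : ℕ) :
    hyperCoeff p a b M (m + 1) = hyperCoeff p a b M m *
      (((p ^ m - M) * (1 - a * p ^ (m + 1))) / ((1 - p ^ (m + 1)) * (1 - b * p ^ (m + 1)))) := by
  rw [hyperCoeff, Finset.prod_range_succ, hyperCoeff]

lemma hyperCoeff_contiguous_denom (hp : ∀ k : ℕ, 1 - p ^ (k + 1) ≠ 0) {b : K}
    (hb : ∀ k : ℕ, 1 - b * p ^ (k + 1) ≠ 0) (m : ℕ) :
    hyperCoeff p a b M m * (1 - b * p) =
      hyperCoeff p a (b * p) M m * (1 - b * p ^ (m + 1)) := by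
  induction m with
  | zero => simp [hyperCoeff_zero]
  | succ m ih =>
    have h1 := hp m
    have h2 := hb m
    have h3 : 1 - b * p * p ^ (m + 1) ≠ 0 := by
      have := hb (m + 1); rwa [show b * p ^ (m + 1 + 1) = b * p * p ^ (m + 1) by ring] at this
    rw [hyperCoeff_succ, hyperCoeff_succ, mul_right_comm, ih,
      show b * p ^ (m + 1 + 1) = b * p * p ^ (m + 1) by ring]
    field_simp

lemma hyperCoeff_contiguous_num {b : K} (hp : ∀ k : ℕ, 1 - p ^ (k + 1) ≠ 0)
    (hb : ∀ k : ℕ, 1 - b * p ^ (k + 1) ≠ 0) (m : ℕ) :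
    hyperCoeff p (a * p) b M m * (1 - a * p) =
      hyperCoeff p a b M m * (1 - a * p ^ (m + 1)) := by
  induction m with
  | zero => simp [hyperCoeff_zero]
  | succ m ih =>
    have h1 := hp m
    have h2 := hb m
    rw [hyperCoeff_succ, hyperCoeff_succ, mul_right_comm, ih]
    field_simp
    ring

lemma hyperCoeff_contiguous_terminator {b : K} (hp : ∀ k : ℕ, 1 - p ^ (k + 1) ≠ 0)
    (hb : ∀ k : ℕ, 1 - b * p ^ (k + 1) ≠ 0) (m : ℕ) :
    hyperCoeff p a b (M * p) m * (p ^ m - M * p) =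
      hyperCoeff p a b M m * (p ^ m * (1 - M * p)) := by
  induction m with
  | zero => simp [hyperCoeff_zero]
  | succ m ih =>
    have h1 := hp m
    have h2 := hb m
    have e : hyperCoeff p a b (M * p) (m + 1) * (p ^ (m + 1) - M * p) =
        (hyperCoeff p a b (M * p) m * (p ^ m - M * p)) * ((p ^ (m + 1) - M * p) *
        (1 - a * p ^ (m + 1))) / ((1 - p ^ (m + 1)) * (1 - b * p ^ (m + 1))) := by
      rw [hyperCoeff_succ]; ring
    rw [e, ih, hyperCoeff_succ]
    field_simp
    ring

/-- Partial sums of the very-well-poised series. -/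
def wellPoisedSum (p a M : K) (m : ℕ) : K :=
  1 + ∑ i ∈ Finset.range m, hyperCoeff p a (a * M) M (i + 1) *
    ((1 - a * p ^ (2 * i + 2)) / (1 - a * p ^ (i + 1)))

/-- Partial sums of the companion of the very-well-poised series, with `1 - a x ^ 2`
replaced by `1 - 2 a x + a x ^ 2`. -/
def companionSum (p a M : K) (m : ℕ) : K :=
  1 + ∑ i ∈ Finset.range m, hyperCoeff p a (a * M) M (i + 1) *
    ((1 - 2 * a * p ^ (i + 1) + a * p ^ (2 * i + 2)) / (1 - a * p ^ (i + 1)))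

lemma wellPoisedSum_succ (m : ℕ) : wellPoisedSum p a M (m + 1) = wellPoisedSum p a M m +
    hyperCoeff p a (a * M) M (m + 1) * ((1 - a * p ^ (2 * m + 2)) / (1 - a * p ^ (m + 1))) := by
  simp [wellPoisedSum, Finset.sum_range_succ, add_assoc]

lemma companionSum_succ (m : ℕ) : companionSum p a M (m + 1) = companionSum p a M m +
    hyperCoeff p a (a * M) M (m + 1) *
      ((1 - 2 * a * p ^ (m + 1) + a * p ^ (2 * m + 2)) / (1 - a * p ^ (m + 1))) := by
  simp [companionSum, Finset.sum_range_succ, add_assoc]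

lemma wellPoisedSum_telescope (hp : ∀ k : ℕ, 1 - p ^ (k + 1) ≠ 0)
    (ha : ∀ k : ℕ, 1 - a * p ^ (k + 1) ≠ 0) (hb : ∀ k : ℕ, 1 - a * M * p ^ (k + 1) ≠ 0) (m : ℕ) :
    (1 - a * p * M ^ 2) * wellPoisedSum p a (M * p) m -
      (1 + M) * (1 - a * M * p) * wellPoisedSum p a M m =
    M * (a * p ^ (2 * m + 1) - 1) * hyperCoeff p a (a * M * p) M m := by
  induction m with
  | zero => simp [wellPoisedSum, hyperCoeff_zero]; ring
  | succ m ih =>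
    have hb' : ∀ k : ℕ, 1 - a * M * p * p ^ (k + 1) ≠ 0 := fun k => by
      have := hb (k + 1); rwa [show a * M * p ^ (k + 1 + 1) = a * M * p * p ^ (k + 1) by ring] at this
    have h1 := hp m
    have h2 := ha m
    have h3 := hb m
    have h4 := hb' m
    have e1 := hyperCoeff_contiguous_denom (a := a) (M := M) hp hb m
    have e2 := hyperCoeff_contiguous_terminator (a := a) (M := M) hp hb' m
    have f1 : (1 - a * M * p) * (hyperCoeff p a (a * M) M (m + 1) *
        ((1 - a * p ^ (2 * m + 2)) / (1 - a * p ^ (m + 1)))) =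
        hyperCoeff p a (a * M * p) M m * ((p ^ m - M) * (1 - a * p ^ (2 * m + 2)) /
          (1 - p ^ (m + 1))) := by
      rw [hyperCoeff_succ]
      field_simp
      linear_combination (p ^ m - M) * (1 - a * p ^ (2 * (m + 1))) * e1
    have f2 : hyperCoeff p a (a * (M * p)) (M * p) (m + 1) *
        ((1 - a * p ^ (2 * m + 2)) / (1 - a * p ^ (m + 1))) =
        hyperCoeff p a (a * M * p) M m * ((p ^ m * (1 - M * p)) * (1 - a * p ^ (2 * m + 2)) /
          ((1 - p ^ (m + 1)) * (1 - a * M * p * p ^ (m + 1)))) := by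
      rw [hyperCoeff_succ, ← mul_assoc a M p]
      field_simp
      linear_combination (1 - a * p ^ (2 * (m + 1))) * e2
    rw [wellPoisedSum_succ, wellPoisedSum_succ, hyperCoeff_succ (a * M * p), f2]
    have key : (1 - a * p * M ^ 2) * (p ^ m * (1 - M * p) * (1 - a * p ^ (2 * m + 2)) /
          ((1 - p ^ (m + 1)) * (1 - a * M * p * p ^ (m + 1)))) -
        (1 + M) * ((p ^ m - M) * (1 - a * p ^ (2 * m + 2)) / (1 - p ^ (m + 1))) =
        M * (a * p ^ (2 * (m + 1) + 1) - 1) * ((p ^ m - M) * (1 - a * p ^ (m + 1)) /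
          ((1 - p ^ (m + 1)) * (1 - a * M * p * p ^ (m + 1)))) -
        M * (a * p ^ (2 * m + 1) - 1) := by
      obtain ⟨D, hD⟩ : ∃ D, D = 1 - a * M * p * p ^ (m + 1) := ⟨_, rfl⟩
      rw [← hD] at h4 ⊢
      field_simp
      rw [hD]
      ring
    linear_combination ih - (1 + M) * f1 + hyperCoeff p a (a * M * p) M m * key

lemma companionSum_telescope (hp : ∀ k : ℕ, 1 - p ^ (k + 1) ≠ 0)
    (ha : ∀ k : ℕ, 1 - a * p ^ (k + 1) ≠ 0) (hb : ∀ k : ℕ, 1 - a * M * p ^ (k + 1) ≠ 0) (m : ℕ) :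
    (1 - a * M * p) * companionSum p a M m - (1 - a * p) * wellPoisedSum p (a * p) M m =
      hyperCoeff p a (a * M * p) M m * ((p ^ m - M) * (a * p ^ (m + 1))) := by
  induction m with
  | zero => simp [wellPoisedSum, companionSum, hyperCoeff_zero]; ring
  | succ m ih =>
    have hb' : ∀ k : ℕ, 1 - a * M * p * p ^ (k + 1) ≠ 0 := fun k => by
      have := hb (k + 1); rwa [show a * M * p ^ (k + 1 + 1) = a * M * p * p ^ (k + 1) by ring] at this
    have h1 := hp m
    have h2 := ha m
    have h3 := hb m
    have h4 := hb' m
    have h5 : 1 - a * p * p ^ (m + 1) ≠ 0 := by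
      have := ha (m + 1); rwa [show a * p ^ (m + 1 + 1) = a * p * p ^ (m + 1) by ring] at this
    have e1 := hyperCoeff_contiguous_denom (a := a) (M := M) hp hb m
    have e2 := hyperCoeff_contiguous_num (a := a) (M := M) hp hb' m
    have f1 : (1 - a * M * p) * (hyperCoeff p a (a * M) M (m + 1) *
        ((1 - 2 * a * p ^ (m + 1) + a * p ^ (2 * m + 2)) / (1 - a * p ^ (m + 1)))) =
        hyperCoeff p a (a * M * p) M m * ((p ^ m - M) *
          (1 - 2 * a * p ^ (m + 1) + a * p ^ (2 * m + 2)) / (1 - p ^ (m + 1))) := by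
      rw [hyperCoeff_succ]
      field_simp
      linear_combination
        (p ^ m - M) * (1 - 2 * a * p ^ (m + 1) + a * p ^ (2 * (m + 1))) * e1
    have f2 : (1 - a * p) * (hyperCoeff p (a * p) (a * p * M) M (m + 1) *
        ((1 - a * p * p ^ (2 * m + 2)) / (1 - a * p * p ^ (m + 1)))) =
        hyperCoeff p a (a * M * p) M m * ((p ^ m - M) * (1 - a * p ^ (m + 1)) *
          (1 - a * p * p ^ (2 * m + 2)) /
          ((1 - p ^ (m + 1)) * (1 - a * M * p * p ^ (m + 1)))) := by
      rw [hyperCoeff_succ, mul_right_comm a p M]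
      generalize hyperCoeff p (a * p) (a * M * p) M m = A at e2 ⊢
      generalize hyperCoeff p a (a * M * p) M m = B at e2 ⊢
      obtain ⟨D, hD⟩ : ∃ D, D = 1 - a * M * p * p ^ (m + 1) := ⟨_, rfl⟩
      rw [← hD] at h4 ⊢
      field_simp
      linear_combination (p ^ m - M) * (1 - a * p * p ^ (2 * (m + 1))) * e2
    have key : (p ^ m - M) * (1 - 2 * a * p ^ (m + 1) + a * p ^ (2 * m + 2)) / (1 - p ^ (m + 1)) -
        (p ^ m - M) * (1 - a * p ^ (m + 1)) * (1 - a * p * p ^ (2 * m + 2)) /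
          ((1 - p ^ (m + 1)) * (1 - a * M * p * p ^ (m + 1))) =
        (p ^ m - M) * (1 - a * p ^ (m + 1)) /
          ((1 - p ^ (m + 1)) * (1 - a * M * p * p ^ (m + 1))) *
          ((p ^ (m + 1) - M) * (a * p ^ (m + 1 + 1))) - (p ^ m - M) * (a * p ^ (m + 1)) := by
      obtain ⟨D, hD⟩ : ∃ D, D = 1 - a * M * p * p ^ (m + 1) := ⟨_, rfl⟩
      rw [← hD] at h4 ⊢
      field_simp
      rw [hD]
      ring
    rw [wellPoisedSum_succ, companionSum_succ, hyperCoeff_succ (a * M * p)]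
    linear_combination ih + f1 - f2 + hyperCoeff p a (a * M * p) M m * key

lemma hyperCoeff_pow_eq_zero (b : K) (N : ℕ) : hyperCoeff p a b (p ^ N) (N + 1) = 0 := by
  simp [hyperCoeff_succ]

lemma wellPoisedSum_pow_eq_prod (hp : ∀ k : ℕ, 1 - p ^ (k + 1) ≠ 0)
    (ha : ∀ k : ℕ, 1 - a * p ^ (k + 1) ≠ 0) (N : ℕ) :
    wellPoisedSum p a (p ^ N) N =
      ∏ j ∈ Finset.range N, (1 + p ^ j) * (1 - a * p ^ (j + 1)) / (1 - a * p ^ (2 * j + 1)) := by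
  induction N with
  | zero => simp [wellPoisedSum]
  | succ N ih =>
    have hb : ∀ k : ℕ, 1 - a * p ^ N * p ^ (k + 1) ≠ 0 := fun k => by
      have := ha (N + k); rwa [show a * p ^ (N + k + 1) = a * p ^ N * p ^ (k + 1) by ring] at this
    have h := wellPoisedSum_telescope hp ha hb (N + 1)
    rw [hyperCoeff_pow_eq_zero, wellPoisedSum_succ (M := p ^ N), hyperCoeff_pow_eq_zero, ih] at h
    rw [Finset.prod_range_succ, pow_succ p N]
    have h1 := ha (2 * N)
    field_simp
    linear_combination h

lemma companionSum_pow_eq_prod (hp : ∀ k : ℕ, 1 - p ^ (k + 1) ≠ 0)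
    (ha : ∀ k : ℕ, 1 - a * p ^ (k + 1) ≠ 0) (N : ℕ) :
    companionSum p a (p ^ N) N =
      ∏ j ∈ Finset.range N, (1 + p ^ j) * (1 - a * p ^ (j + 1)) / (1 - a * p ^ (2 * j + 2)) := by
  have hb : ∀ k : ℕ, 1 - a * p ^ N * p ^ (k + 1) ≠ 0 := fun k => by
    have := ha (N + k); rwa [show a * p ^ (N + k + 1) = a * p ^ N * p ^ (k + 1) by ring] at this
  have ha' : ∀ k : ℕ, 1 - a * p * p ^ (k + 1) ≠ 0 := fun k => by
    have := ha (k + 1); rwa [show a * p ^ (k + 1 + 1) = a * p * p ^ (k + 1) by ring] at this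
  have h := companionSum_telescope hp ha hb N
  rw [wellPoisedSum_pow_eq_prod hp ha', sub_self, zero_mul, mul_zero, sub_eq_zero] at h
  have h0 := hb 0
  rw [zero_add, pow_one] at h0
  refine mul_left_cancel₀ h0 (h.trans ?_)
  clear h h0 hb
  induction N with
  | zero => simp
  | succ N ih =>
    rw [Finset.prod_range_succ, Finset.prod_range_succ, ← mul_assoc, ih]
    have h1 := ha (2 * N + 1)
    have h2 : 1 - a * p * p ^ (2 * N + 1) ≠ 0 := ha' (2 * N)
    rw [show a * p * p ^ (2 * N + 1) = a * p ^ (2 * N + 2) by ring]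
    field_simp
    ring

end Hypergeometric

lemma q_ne_zero : q ≠ 0 := RatFunc.X_ne_zero

lemma one_sub_q_pow_ne_zero (k : ℕ) : 1 - q ^ (k + 1) ≠ 0 := by
  intro h
  have h' : algebraMap (Polynomial ℚ) (RatFunc ℚ) (1 - Polynomial.X ^ (k + 1)) = 0 := by
    simpa [q, RatFunc.algebraMap_X] using h
  rw [map_eq_zero_iff _ (RatFunc.algebraMap_injective ℚ)] at h'
  simpa using congrArg (Polynomial.eval 0) h'

lemma one_sub_q_ne_zero : 1 - q ≠ 0 := by simpa using one_sub_q_pow_ne_zero 0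

lemma one_sub_q_pow_mul_ne_zero (c k : ℕ) : 1 - q ^ c * q ^ (k + 1) ≠ 0 := by
  rw [← pow_add]
  exact one_sub_q_pow_ne_zero (c + k)

lemma qb_natCast (m : ℕ) : qb m = (1 - q ^ m) / (1 - q) := by
  rw [qb, zpow_natCast]

lemma qb_succ_ne_zero (m : ℕ) : qb ((m : ℤ) + 1) ≠ 0 := by
  have := qb_natCast (m + 1)
  push_cast at this
  rw [this]
  exact div_ne_zero (one_sub_q_pow_ne_zero m) one_sub_q_ne_zero

lemma qb_neg (a : ℤ) : q ^ a * qb (-a) = -qb a := by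
  have h := zpow_ne_zero a q_ne_zero
  have h1 := one_sub_q_ne_zero
  rw [qb, qb, zpow_neg]
  field_simp
  ring

lemma qfac_zero (a : ℤ) : qfac a 0 = 1 := by simp [qfac]

lemma qfac_succ (a : ℤ) (n : ℕ) : qfac a (n + 1) = qfac a n * qb (a + n) := by
  rw [qfac, Finset.prod_range_succ, qfac]

lemma qfac_add (a : ℤ) (m n : ℕ) : qfac a (m + n) = qfac a m * qfac (a + m) n := by
  rw [qfac, Finset.prod_range_add, qfac, qfac]
  simp [add_assoc]

lemma qfac_one (a : ℤ) : qfac a 1 = qb a := by simp [qfac]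

lemma qfac_succ' (a : ℤ) (n : ℕ) : qfac a (n + 1) = qb a * qfac (a + 1) n := by
  rw [add_comm n 1, qfac_add, qfac_one, Nat.cast_one]

lemma qfac_ne_zero (m n : ℕ) : qfac ((m : ℤ) + 1) n ≠ 0 := by
  refine Finset.prod_ne_zero_iff.2 fun i _ => ?_
  have := qb_succ_ne_zero (m + i)
  push_cast at this
  rwa [show (m : ℤ) + 1 + i = m + i + 1 by ring]

lemma qfac_reflect (a : ℤ) (n : ℕ) :
    (∏ k ∈ Finset.range n, q ^ (a + k)) * qfac (1 - a - n) n = (-1) ^ n * qfac a n := by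
  induction n with
  | zero => simp [qfac_zero]
  | succ n ih =>
    rw [Finset.prod_range_succ, qfac_succ', qfac_succ, pow_succ,
      show 1 - a - ((n + 1 : ℕ) : ℤ) + 1 = 1 - a - n by push_cast; ring,
      show 1 - a - ((n + 1 : ℕ) : ℤ) = -(a + n) by push_cast; ring]
    linear_combination (q ^ (a + n) * qb (-(a + n))) * ih +
      (-1) ^ n * qfac a n * qb_neg (a + n)

lemma prod_q_zpow (c N : ℕ) :
    ∏ k ∈ Finset.range N, q ^ ((c : ℤ) + 1 + k) = q ^ ((N : ℤ) * (2 * c + (N + 1)) / 2) := by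
  induction N with
  | zero => simp
  | succ N ih =>
    rw [Finset.prod_range_succ, ih, ← zpow_add₀ q_ne_zero]
    congr 1
    rw [show ((N + 1 : ℕ) : ℤ) * (2 * c + ((N + 1 : ℕ) + 1)) =
      N * (2 * c + (N + 1)) + 2 * (c + 1 + N) by push_cast; ring,
      Int.add_mul_ediv_left _ _ two_ne_zero]

lemma hyperCoeff_mul_qfac (c i l : ℕ) :
    hyperCoeff q (q ^ c) (q ^ c * q ^ (i + l)) (q ^ (i + l)) i *
      (qfac 1 i * qfac 1 l * qfac (c + i + 1) (i + l)) =
    q ^ (i * (i - 1) / 2) * (qfac 1 (i + l) * qfac (c + 1) (i + l)) := by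
  suffices ∀ N i l : ℕ, i + l = N →
      hyperCoeff q (q ^ c) (q ^ c * q ^ N) (q ^ N) i *
        (qfac 1 i * qfac 1 l * qfac (c + i + 1) N) =
      q ^ (i * (i - 1) / 2) * (qfac 1 N * qfac (c + 1) N) from this _ i l rfl
  intro N i
  induction i with
  | zero =>
    rintro l hl
    obtain rfl : l = N := by omega
    simp [hyperCoeff_zero, qfac_zero]
  | succ i ih =>
    intro l hl
    have h := ih (l + 1) (by omega)
    have e : qb (c + i + 1) * qfac (c + i + 1 + 1) N =
        qfac (c + i + 1) N * qb (c + i + 1 + N) := by rw [← qfac_succ', qfac_succ]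
    have b1 : qb (c + i + 1) = (1 - q ^ c * q ^ (i + 1)) / (1 - q) := by
      rw [← pow_add, ← qb_natCast]; push_cast; rw [add_assoc]
    have b2 : qb (c + i + 1 + N) = (1 - q ^ c * q ^ N * q ^ (i + 1)) / (1 - q) := by
      rw [← pow_add, ← pow_add, ← qb_natCast]; push_cast; congr 1; ring
    have b3 : qb (1 + i) = (1 - q ^ (i + 1)) / (1 - q) := by
      rw [← qb_natCast]; push_cast; congr 1; ring
    have b4 : qb (1 + l) = (1 - q ^ (l + 1)) / (1 - q) := by
      rw [← qb_natCast]; push_cast; congr 1; ring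
    have hq := one_sub_q_ne_zero
    have h1 := one_sub_q_pow_ne_zero i
    have h2 : 1 - q ^ c * q ^ N * q ^ (i + 1) ≠ 0 := by
      rw [← pow_add]; exact one_sub_q_pow_mul_ne_zero _ _
    have h3 : q ^ N = q ^ i * q ^ (l + 1) := by rw [← pow_add]; congr 1; omega
    rw [qfac_succ, b4] at h
    rw [b1, b2] at e
    have f : q ^ i - q ^ N = q ^ i * (1 - q ^ (l + 1)) := by rw [h3]; ring
    have hs : hyperCoeff q (q ^ c) (q ^ c * q ^ N) (q ^ N) (i + 1) =
        hyperCoeff q (q ^ c) (q ^ c * q ^ N) (q ^ N) i *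
          ((q ^ i * (1 - q ^ (l + 1)) * (1 - q ^ c * q ^ (i + 1))) /
            ((1 - q ^ (i + 1)) * (1 - q ^ c * q ^ N * q ^ (i + 1)))) := by
      rw [← f]; exact hyperCoeff_succ _ _
    have ht : q ^ ((i + 1) * (i + 1 - 1) / 2) = q ^ (i * (i - 1) / 2) * q ^ i := by
      rw [Nat.triangle_succ, pow_add]
    rw [hs, qfac_succ, b3, ht,
      show (c : ℤ) + (i + 1 : ℕ) + 1 = c + i + 1 + 1 by push_cast; ring]
    clear ih hs ht f h3 b1 b2 b3 b4
    generalize hyperCoeff q (q ^ c) (q ^ c * q ^ N) (q ^ N) i = H at *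
    generalize q ^ c * q ^ N * q ^ (i + 1) = D at *
    generalize q ^ c * q ^ (i + 1) = A at *
    generalize q ^ (i + 1) = B at *
    generalize q ^ (l + 1) = L at *
    generalize qfac 1 i = Q1 at *
    generalize qfac 1 l = Q2 at *
    generalize qfac (c + i + 1) N = Q3 at *
    generalize qfac (c + i + 1 + 1) N = Q4 at *
    generalize qfac 1 N * qfac (c + 1) N = R at *
    generalize q ^ (i * (i - 1) / 2) = T at *
    generalize q ^ i = Y at *
    field_simp at *
    linear_combination H * Y * (1 - L) * Q1 * Q2 * e + (1 - D) * Y * h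

lemma Unc_summand_eq (c j l : ℕ) (ε : RatFunc ℚ) :
    (-1) ^ (j + 1 + l + 1) * (∏ k ∈ Finset.range (j + 1 + l), q ^ ((c : ℤ) + 1 + k)) *
      ((ε * q ^ ((j + 1) * (j + 1 - 1) / 2) *
          (qfac 1 (j + 1 + l) * qfac (1 - (c + 1) - j) j * qfac (1 - (c + j + 1 + 1) - l) l) -
        q ^ ((j + 1) * (j + 1 - 1) / 2) *
          (qfac 1 j * qfac (1 + j + 1) l * qfac (1 - (c + 1) - (j + 1 + l : ℕ)) (j + 1 + l))) /
      (qfac 1 j * qfac 1 l * qfac (c + (j + 1 : ℕ) + 1) (j + 1 + l))) =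
    hyperCoeff q (q ^ c) (q ^ c * q ^ (j + 1 + l)) (q ^ (j + 1 + l)) (j + 1) *
      (1 + ε * (q ^ c * q ^ (j + 1)) * (1 - q ^ (j + 1)) / (1 - q ^ c * q ^ (j + 1))) := by
  have hH := hyperCoeff_mul_qfac c (j + 1) l
  have r1 := qfac_reflect (c + 1) j
  have r2 := qfac_reflect (c + j + 1 + 1) l
  have r3 := qfac_reflect (c + 1) (j + 1 + l)
  have s1 : qfac 1 (j + 1 + l) = qfac 1 j * qb (1 + j) * qfac (1 + j + 1) l := by
    rw [qfac_add, qfac_succ]; push_cast; rw [add_assoc]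
  have s2 : qfac (c + 1) (j + 1 + l) =
      qfac (c + 1) j * qb (c + 1 + j) * qfac (c + j + 1 + 1) l := by
    rw [qfac_add, qfac_succ]; push_cast
    rw [show (c : ℤ) + 1 + (j + 1) = c + j + 1 + 1 by ring]
  have s3 : (∏ k ∈ Finset.range (j + 1 + l), q ^ ((c : ℤ) + 1 + k)) =
      (∏ k ∈ Finset.range j, q ^ ((c : ℤ) + 1 + k)) * (q ^ c * q ^ (j + 1)) *
        ∏ k ∈ Finset.range l, q ^ ((c : ℤ) + j + 1 + 1 + k) := by
    rw [Finset.prod_range_add, Finset.prod_range_succ, ← pow_add, ← zpow_natCast q (c + (j + 1))]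
    push_cast
    rw [show (c : ℤ) + 1 + j = c + (j + 1) by ring]
    congr 1
    refine Finset.prod_congr rfl fun k _ => ?_
    congr 1
    ring
  have b1 : qb (c + 1 + j) = (1 - q ^ c * q ^ (j + 1)) / (1 - q) := by
    rw [← pow_add, ← qb_natCast]; push_cast; congr 1; ring
  have b3 : qb (1 + j) = (1 - q ^ (j + 1)) / (1 - q) := by
    rw [← qb_natCast]; push_cast; congr 1; ring
  have hq := one_sub_q_ne_zero
  have h1 := one_sub_q_pow_ne_zero j
  have h2 := one_sub_q_pow_mul_ne_zero c j
  have n1 : qfac 1 j ≠ 0 := by simpa using qfac_ne_zero 0 j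
  have n2 : qfac 1 l ≠ 0 := by simpa using qfac_ne_zero 0 l
  have n3 : qfac (c + (j + 1 : ℕ) + 1) (j + 1 + l) ≠ 0 := by
    have := qfac_ne_zero (c + (j + 1)) (j + 1 + l)
    rwa [Nat.cast_add] at this
  have sq1 : ((-1 : RatFunc ℚ) ^ j) ^ 2 = 1 := by rw [← pow_mul, mul_comm, pow_mul]; simp
  have sq2 : ((-1 : RatFunc ℚ) ^ l) ^ 2 = 1 := by rw [← pow_mul, mul_comm, pow_mul]; simp
  rw [qfac_succ 1 j, b3] at hH
  rw [b3] at s1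
  rw [b1] at s2
  rw [mul_div_assoc', div_eq_iff (mul_ne_zero (mul_ne_zero n1 n2) n3)]
  have r12 : (∏ k ∈ Finset.range (j + 1 + l), q ^ ((c : ℤ) + 1 + k)) *
      (qfac (1 - (c + 1) - j) j * qfac (1 - (c + j + 1 + 1) - l) l) =
      (q ^ c * q ^ (j + 1)) * ((-1) ^ j * (-1) ^ l) *
        (qfac (c + 1) j * qfac (c + j + 1 + 1) l) := by
    rw [s3]
    linear_combination (q ^ c * q ^ (j + 1)) *
      ((∏ k ∈ Finset.range l, q ^ ((c : ℤ) + j + 1 + 1 + k)) *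
        qfac (1 - (c + j + 1 + 1) - l) l * r1 + (-1) ^ j * qfac (c + 1) j * r2)
  clear r1 r2 s3 b1 b3
  generalize (∏ k ∈ Finset.range (j + 1 + l), q ^ ((c : ℤ) + 1 + k)) = P at *
  generalize hyperCoeff q (q ^ c) (q ^ c * q ^ (j + 1 + l)) (q ^ (j + 1 + l)) (j + 1) = H at *
  generalize q ^ ((j + 1) * (j + 1 - 1) / 2) = T at *
  generalize q ^ c * q ^ (j + 1) = A at *
  generalize q ^ (j + 1) = B at *
  generalize qfac (1 - (c + 1) - j) j = X1 at *
  generalize qfac (1 - (c + j + 1 + 1) - l) l = X2 at *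
  generalize qfac (1 - (c + 1) - (j + 1 + l : ℕ)) (j + 1 + l) = X3 at *
  generalize qfac (c + (j + 1 : ℕ) + 1) (j + 1 + l) = D at *
  generalize qfac 1 (j + 1 + l) = F at *
  generalize qfac (c + 1) (j + 1 + l) = G at *
  generalize qfac 1 j = F1 at *
  generalize qfac 1 l = F2 at *
  generalize qfac (1 + j + 1) l = F3 at *
  generalize qfac (c + 1) j = G1 at *
  generalize qfac (c + j + 1 + 1) l = G3 at *
  have sg : (-1 : RatFunc ℚ) ^ (j + 1 + l + 1) = (-1) ^ j * (-1) ^ l := by ring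
  have sg' : (-1 : RatFunc ℚ) ^ (j + 1 + l) = -((-1) ^ j * (-1) ^ l) := by ring
  rw [sg]
  rw [sg'] at r3
  generalize (-1 : RatFunc ℚ) ^ j = σ at *
  generalize (-1 : RatFunc ℚ) ^ l = τ at *
  have hστ : (σ * τ) ^ 2 = 1 := by rw [mul_pow, sq1, sq2, one_mul]
  have hF : F1 * F3 = F * ((1 - q) / (1 - B)) := by rw [s1]; field_simp
  have hG : G1 * G3 = G * ((1 - q) / (1 - A)) := by rw [s2]; field_simp
  have hD : H * (F1 * F2 * D) = T * (F * G) * ((1 - q) / (1 - B)) := by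
    rw [← hH]; field_simp
  have hA : A * (1 - B) / (1 - A) * ((1 - q) / (1 - B)) = A * ((1 - q) / (1 - A)) := by
    field_simp
  linear_combination σ * τ * ε * T * F * r12 - σ * τ * T * F1 * F3 * r3 +
    ε * T * F * A * G1 * G3 * hστ + T * F1 * F3 * G * hστ + ε * T * F * A * hG +
    T * G * hF - (1 + ε * (A * (1 - B) / (1 - A))) * hD - ε * T * F * G * hA

lemma Unc_zero_eq (N c : ℕ) :
    Unc (N + 1) c 0 = 1 + ∑ j ∈ Finset.range N,
      hyperCoeff q (q ^ c) (q ^ c * q ^ N) (q ^ N) (j + 1) *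
        (1 + (-1) ^ c * (q ^ c * q ^ (j + 1)) * (1 - q ^ (j + 1)) /
          (1 - q ^ c * q ^ (j + 1))) := by
  have hP : q ^ ((((N + 1 : ℕ) : ℤ) - 1) * (2 * c + (N + 1 : ℕ)) / 2) =
      ∏ k ∈ Finset.range N, q ^ ((c : ℤ) + 1 + k) := by
    rw [prod_q_zpow]; push_cast; rw [add_sub_cancel_right]
  rw [Unc, hP, mul_zero, zpow_zero, zpow_zero, one_mul, add_comm, Finset.mul_sum]
  congr 1
  rw [show Finset.Icc 1 (N + 1 - 1) = Finset.Ico 1 (N + 1) by ext; simp,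
    Finset.sum_Ico_eq_sum_range, Nat.add_sub_cancel]
  refine Finset.sum_congr rfl fun j hj => ?_
  rw [Finset.mem_range] at hj
  rw [add_comm 1 j]
  obtain ⟨l, rfl⟩ : ∃ l, N = j + 1 + l := ⟨N - (j + 1), by omega⟩
  rw [← Unc_summand_eq]
  have n2 : j + 1 + l + 1 - (j + 1) - 1 = l := by omega
  have n3 : j + 1 + l - (j + 1) = l := by omega
  have n4 : j + 1 - 1 = j := by omega
  rw [n2, n3, n4]
  push_cast
  rw [show (0 : ℤ) - c - (j + 1) + 1 = 1 - (c + 1) - j by ring,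
    show (0 : ℤ) + (j + 1) + 1 = 1 + j + 1 by ring,
    show (0 : ℤ) - c - (j + 1 + l + 1) + 1 = 1 - (c + j + 1 + 1) - l by ring,
    show (1 : ℤ) - (c + 1) - (j + 1 + l) = 1 - (c + j + 1 + 1) - l by ring]

lemma prod_one_add_q_pow (N : ℕ) :
    ∏ j ∈ Finset.range (N + 1), (1 + q ^ j) = 2 * ∏ i ∈ Finset.Icc 1 N, (1 + q ^ i) := by
  rw [Finset.prod_range_succ', pow_zero, one_add_one_eq_two, mul_comm,
    Finset.range_eq_Ico, Finset.prod_Ico_add' (fun j => 1 + q ^ j) 0 N 1]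
  congr 1

lemma one_add_q_ne_zero : 1 + q ≠ 0 := by
  intro h
  apply one_sub_q_pow_ne_zero 1
  linear_combination (1 - q) * h
/-- **Identity (13):** closed form for `U_{n,c}(0)`. -/
theorem statement17 (n c : ℕ) (hn : 2 ≤ n) :
    Unc n c 0 =
      if Even c then
        2 * (∏ i ∈ Finset.Icc 1 (n - 2), (1 + q ^ i)) / (1 + q) ^ (n - 1) *
          ∏ i ∈ Finset.range (n - 1),
            (1 - q ^ (c + 1 + i)) * (1 - q ^ 2) / ((1 - q) * (1 - q ^ (c + 1 + 2 * i)))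
      else
        2 * (∏ i ∈ Finset.Icc 1 (n - 2), (1 + q ^ i)) / (1 + q) ^ n *
          ∏ i ∈ Finset.range n,
            (1 - q ^ (c + i)) * (1 - q ^ 2) / ((1 - q) * (1 - q ^ (c + 2 * i))) := by
  obtain ⟨N, rfl⟩ : ∃ N, n = N + 1 + 1 := ⟨n - 2, by omega⟩
  have n1 : N + 1 + 1 - 2 = N := by omega
  have n2 : N + 1 + 1 - 1 = N + 1 := by omega
  have hq := one_sub_q_ne_zero
  have hq' := one_add_q_ne_zero
  have hpow : ∀ m : ℕ, (1 + q) ^ m = ∏ _j ∈ Finset.range m, (1 + q) := by simp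
  rw [Unc_zero_eq, n1, n2, ← prod_one_add_q_pow]
  split_ifs with hc
  · trans wellPoisedSum q (q ^ c) (q ^ (N + 1)) (N + 1)
    · rw [wellPoisedSum, hc.neg_one_pow]
      congr 1
      refine Finset.sum_congr rfl fun j _ => ?_
      have h := one_sub_q_pow_mul_ne_zero c j
      congr 1
      field_simp
      ring
    · rw [wellPoisedSum_pow_eq_prod one_sub_q_pow_ne_zero (one_sub_q_pow_mul_ne_zero c)]
      rw [hpow, ← Finset.prod_div_distrib, ← Finset.prod_mul_distrib]
      refine Finset.prod_congr rfl fun j _ => ?_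
      have h : 1 - q ^ (c + 1 + 2 * j) ≠ 0 := by
        rw [add_right_comm]; exact one_sub_q_pow_ne_zero _
      rw [show q ^ c * q ^ (2 * j + 1) = q ^ (c + 1 + 2 * j) by ring,
        show q ^ c * q ^ (j + 1) = q ^ (c + 1 + j) by ring]
      field_simp
      ring
  · rw [Nat.not_even_iff_odd] at hc
    trans companionSum q (q ^ c) (q ^ (N + 1)) (N + 1)
    · rw [companionSum, hc.neg_one_pow]
      congr 1
      refine Finset.sum_congr rfl fun j _ => ?_
      have h := one_sub_q_pow_mul_ne_zero c j
      congr 1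
      field_simp
      ring
    · obtain ⟨d, rfl⟩ : ∃ d, c = d + 1 := ⟨c - 1, by have := hc.pos; omega⟩
      have h0 := one_sub_q_pow_ne_zero d
      rw [companionSum_pow_eq_prod one_sub_q_pow_ne_zero (one_sub_q_pow_mul_ne_zero (d + 1)),
        Finset.prod_range_succ' _ (N + 1), mul_zero, add_zero, pow_succ _ (N + 1), hpow,
        show (1 - q ^ (d + 1)) * (1 - q ^ 2) / ((1 - q) * (1 - q ^ (d + 1))) = 1 + q by
          field_simp; ring,
        show ∀ x y z : RatFunc ℚ, x / (y * (1 + q)) * (z * (1 + q)) = x / y * z from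
          fun x y z => by rw [← div_div]; field_simp,
        ← Finset.prod_div_distrib, ← Finset.prod_mul_distrib]
      refine Finset.prod_congr rfl fun j _ => ?_
      have h : 1 - q ^ (d + 1 + 2 * (j + 1)) ≠ 0 := by
        rw [mul_add, ← add_assoc]; exact one_sub_q_pow_ne_zero _
      rw [show q ^ (d + 1) * q ^ (2 * j + 2) = q ^ (d + 1 + 2 * (j + 1)) by ring,
        show q ^ (d + 1) * q ^ (j + 1) = q ^ (d + 1 + (j + 1)) by ring]
      field_simp
      ring
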